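/- Let H be a real Hilbert space, y⁰ ∈ D(∂φ), and let y ∈ H¹(0,T;H), η ∈ L²(0,T;H) solve the gradient flow ẏ(t) + η(t) = u(t), η(t) ∈ ∂φ(y(t)) a.e., y(0) = y⁰, with u ∈ L²(0,T;H). Then (1/2)‖ẏ‖²_{L²(0,T;H)} + ‖η‖²_{L²(0,T;H)} ≤ ‖u‖²_{L²(0,T;H)} + 2T ‖(∂φ(y⁰))°‖², where (∂φ(y⁰))° is the minimal-norm element of ∂φ(y⁰), provided additionally κ = 0 (φ convex). -/

import Mathlib

open MeasureTheory Set
open scoped RealInnerProductSpace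

open Filter Topology in
lemma aux_fatou {μ : Measure ℝ} {F : ℕ → ℝ → ℝ} {G : ℝ → ℝ} {C : ℝ}
    (hF : ∀ n, Integrable (F n) μ) (hF0 : ∀ n, ∀ᵐ t ∂μ, 0 ≤ F n t)
    (hG : Integrable G μ) (hlim : ∀ᵐ t ∂μ, Tendsto (fun n => F n t) atTop (𝓝 (G t)))
    (hC : ∀ n, ∫ t, F n t ∂μ ≤ C) : ∫ t, G t ∂μ ≤ C := by
  have hG0 : 0 ≤ᵐ[μ] G := by
    filter_upwards [hlim, ae_all_iff.2 hF0] with t h1 h2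
    exact ge_of_tendsto' h1 h2
  have hC0 : 0 ≤ C := (integral_nonneg_of_ae (hF0 0)).trans (hC 0)
  rw [← ENNReal.ofReal_le_ofReal_iff hC0, ofReal_integral_eq_lintegral_ofReal hG hG0]
  calc ∫⁻ t, ENNReal.ofReal (G t) ∂μ
      = ∫⁻ t, liminf (fun n => ENNReal.ofReal (F n t)) atTop ∂μ := by
        apply lintegral_congr_ae
        filter_upwards [hlim] with t ht
        exact (ENNReal.tendsto_ofReal ht).liminf_eq.symm
    _ ≤ liminf (fun n => ∫⁻ t, ENNReal.ofReal (F n t) ∂μ) atTop :=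
        lintegral_liminf_le' (fun n => (hF n).aestronglyMeasurable.aemeasurable.ennreal_ofReal)
    _ ≤ ENNReal.ofReal C := by
        refine liminf_le_of_le (by isBoundedDefault) ?_
        intro b hb
        obtain ⟨n, hn⟩ := hb.exists
        refine hn.trans ?_
        rw [← ofReal_integral_eq_lintegral_ofReal (hF n) (hF0 n)]
        exact ENNReal.ofReal_le_ofReal (hC n)

open Filter Topology in
lemma aux_slope {E : Type*} [NormedAddCommGroup E] [NormedSpace ℝ E] {f : ℝ → E} {f' : E} {t : ℝ}
    (hf : HasDerivAt f f' t) :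
    Tendsto (fun n : ℕ => (1 / ((n : ℝ) + 1))⁻¹ • (f t - f (t - 1 / ((n : ℝ) + 1)))) atTop
      (𝓝 f') := by
  have h1 : Tendsto (fun n : ℕ => -(1 / ((n : ℝ) + 1))) atTop (𝓝[<] 0) := by
    refine tendsto_nhdsWithin_iff.2 ⟨?_, ?_⟩
    · simpa using (tendsto_one_div_add_atTop_nhds_zero_nat (𝕜 := ℝ)).neg
    · refine Eventually.of_forall fun n => ?_
      have : 0 < 1 / ((n : ℝ) + 1) := by positivity
      simpa using this
  refine (hf.tendsto_slope_zero_left.comp h1).congr fun n => ?_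
  simp only [Function.comp]
  rw [inv_neg, neg_smul, ← smul_neg, neg_sub, ← sub_eq_add_neg]

lemma aux_shift {m : ℝ → ℝ} {T h : ℝ} (hT : 0 < T) (hh : 0 < h) (hm : Integrable m)
    (hm0 : ∀ t, 0 ≤ m t) (hmz : ∀ t, t ≤ 0 → m t = 0) :
    ∫ t in Ioc 0 T, ((∫ s in (0:ℝ)..t, m s) - ∫ s in (0:ℝ)..(t - h), m s) ≤ h * ∫ t, m t := by
  have hcont : Continuous (fun t => ∫ s in (0:ℝ)..t, m s) :=
    intervalIntegral.continuous_primitive (fun a b => hm.intervalIntegrable) 0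
  set Φ : ℝ → ℝ := fun t => ∫ s in (0:ℝ)..t, m s with hΦ
  have hΦz : ∀ t, t ≤ 0 → Φ t = 0 := by
    intro t ht
    simp only [hΦ]
    rw [intervalIntegral.integral_symm, intervalIntegral.integral_of_le ht, neg_eq_zero]
    apply setIntegral_eq_zero_of_forall_eq_zero
    intro s hs
    exact hmz s hs.2
  have hΦM : ∀ t, Φ t ≤ ∫ t, m t := by
    intro t
    rcases le_total t 0 with ht | ht
    · rw [hΦz t ht]; exact integral_nonneg hm0
    · simp only [hΦ]
      rw [intervalIntegral.integral_of_le ht]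
      exact setIntegral_le_integral hm (Filter.Eventually.of_forall hm0)
  change ∫ t in Ioc 0 T, (Φ t - Φ (t - h)) ≤ _
  have hii : ∀ a b, IntervalIntegrable Φ volume a b := fun a b => hcont.intervalIntegrable a b
  have hc2 : Continuous fun t => Φ (t - h) := by fun_prop
  rw [← intervalIntegral.integral_of_le hT.le,
    intervalIntegral.integral_sub (hii _ _) (hc2.intervalIntegrable _ _),
    intervalIntegral.integral_comp_sub_right (fun t => Φ t) h,
    intervalIntegral.integral_interval_sub_interval_comm' (hii _ _) (hii _ _) (hii _ _)]
  have h1 : ∫ t in (0 - h)..0, Φ t = 0 := by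
    rw [intervalIntegral.integral_of_le (by linarith)]
    apply setIntegral_eq_zero_of_forall_eq_zero
    intro s hs
    exact hΦz s hs.2
  have h2 : ∫ t in (T - h)..T, Φ t ≤ ∫ t in (T - h)..T, (∫ t, m t) :=
    intervalIntegral.integral_mono_on (by linarith) (hii _ _) (by simp) (fun x _ => hΦM x)
  rw [intervalIntegral.integral_const] at h2
  simp only [smul_eq_mul] at h2
  rw [h1]
  linarith

lemma aux_meas {H : Type*} [NormedAddCommGroup H] [InnerProductSpace ℝ H] {y y' : ℝ → H}
    (hy : ∀ t, HasDerivAt y (y' t) t) (v : H) : Measurable (fun t => ⟪v, y' t⟫) := by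
  have h1 : ∀ t, HasDerivAt (fun t => ⟪v, y t⟫) (⟪v, y' t⟫) t := by
    intro t
    simpa using (hasDerivAt_const t v).inner ℝ (hy t)
  have h2 : (fun t => ⟪v, y' t⟫) = deriv (fun t => ⟪v, y t⟫) := by
    funext t
    exact (h1 t).deriv.symm
  rw [h2]
  exact measurable_deriv _

lemma aux_meas_norm {H : Type*} [NormedAddCommGroup H] [InnerProductSpace ℝ H] {y y' D : ℝ → H}
    (hy : ∀ t, HasDerivAt y (y' t) t) (hD : Continuous D) :
    Measurable (fun t => ‖D t - y' t‖) := by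
  have hyc : Continuous y := continuous_iff_continuousAt.2 fun t => (hy t).continuousAt
  refine measurable_of_tendsto_metrizable (f := fun (n : ℕ) t =>
    ‖D t - (1 / ((n : ℝ) + 1))⁻¹ • (y t - y (t - 1 / ((n : ℝ) + 1)))‖) ?_ ?_
  · intro n
    have : Continuous fun t =>
      ‖D t - (1 / ((n : ℝ) + 1))⁻¹ • (y t - y (t - 1 / ((n : ℝ) + 1)))‖ := by fun_prop
    exact this.measurable
  · rw [tendsto_pi_nhds]
    intro t
    exact (tendsto_const_nhds.sub (aux_slope (hy t))).norm

lemma aux_incr {H : Type*} [NormedAddCommGroup H] [InnerProductSpace ℝ H] {y y' : ℝ → H}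
    (hy : ∀ t, HasDerivAt y (y' t) t) {s t h : ℝ} (hst : s ≤ t) (hts : t ≤ s + h) (hh : 0 < h)
    (hi : IntervalIntegrable (fun r => ‖y' r‖ ^ 2) volume s t) :
    ‖y t - y s‖ ^ 2 ≤ h * ∫ r in s..t, ‖y' r‖ ^ 2 := by
  set e := y t - y s with he
  have hpt : ∀ r, |⟪e, y' r⟫| ≤ ‖e‖ ^ 2 / (2 * h) + h / 2 * ‖y' r‖ ^ 2 := by
    intro r
    refine (abs_real_inner_le_norm _ _).trans ?_
    have : ‖e‖ ^ 2 / (2 * h) + h / 2 * ‖y' r‖ ^ 2 - ‖e‖ * ‖y' r‖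
        = (‖e‖ - h * ‖y' r‖) ^ 2 / (2 * h) := by
      field_simp
      ring
    have h2 : 0 ≤ (‖e‖ - h * ‖y' r‖) ^ 2 / (2 * h) := by positivity
    linarith
  have hib : IntervalIntegrable (fun r => ‖e‖ ^ 2 / (2 * h) + h / 2 * ‖y' r‖ ^ 2) volume s t :=
    (intervalIntegrable_const).add (hi.const_mul _)
  have hie : IntervalIntegrable (fun r => ⟪e, y' r⟫) volume s t := by
    refine hib.mono_fun (aux_meas hy e).aestronglyMeasurable ?_
    refine Filter.Eventually.of_forall fun r => ?_
    exact (hpt r).trans (le_abs_self _)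
  have hftc : ∫ r in s..t, ⟪e, y' r⟫ = ⟪e, y t⟫ - ⟪e, y s⟫ := by
    refine intervalIntegral.integral_eq_sub_of_hasDerivAt (f := fun r => ⟪e, y r⟫) ?_ hie
    intro r _
    simpa using (hasDerivAt_const r e).inner ℝ (hy r)
  have hle : ∫ r in s..t, ⟪e, y' r⟫ ≤
      ∫ r in s..t, (‖e‖ ^ 2 / (2 * h) + h / 2 * ‖y' r‖ ^ 2) :=
    intervalIntegral.integral_mono_on hst hie hib
      (fun r _ => (le_abs_self _).trans (hpt r))
  rw [hftc, ← inner_sub_right, ← he, real_inner_self_eq_norm_sq,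
    intervalIntegral.integral_add intervalIntegrable_const (hi.const_mul _),
    intervalIntegral.integral_const, intervalIntegral.integral_const_mul, smul_eq_mul] at hle
  have h3 : (t - s) * (‖e‖ ^ 2 / (2 * h)) ≤ h * (‖e‖ ^ 2 / (2 * h)) :=
    mul_le_mul_of_nonneg_right (by linarith) (by positivity)
  have h4 : h * (‖e‖ ^ 2 / (2 * h)) = ‖e‖ ^ 2 / 2 := by field_simp
  linarith

open Filter Topology in
lemma aux_key {H : Type*} [NormedAddCommGroup H] [InnerProductSpace ℝ H] {y y' ζ : ℝ → H}
    {k ψ : ℝ → ℝ} {T : ℝ} (hT : 0 < T)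
    (hy : ∀ t, HasDerivAt y (y' t) t)
    (hiy' : IntegrableOn (fun t => ‖y' t‖ ^ 2) (Ioc 0 T))
    (hkm : AEMeasurable k (volume.restrict (Ioc 0 T)))
    (hk2 : IntegrableOn (fun t => k t ^ 2) (Ioc 0 T))
    (hk : ∀ t, ‖ζ t‖ ≤ k t)
    (hζ : IntegrableOn (fun t => ⟪ζ t, y' t⟫) (Ioc 0 T))
    (hψ : Integrable ψ) (hψ0 : ∀ᵐ t, 0 ≤ ψ t) (hψz : ∀ t, t ∉ Ioc 0 T → ψ t = 0)
    (hineq : ∀ h : ℝ, 0 < h → ∀ᵐ t ∂(volume.restrict (Ioc 0 T)),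
      ψ t - ψ (t - h) ≤ ⟪ζ t, y (max t 0) - y (max (t - h) 0)⟫) :
    0 ≤ ∫ t in Ioc 0 T, ⟪ζ t, y' t⟫ := by
  have hyc : Continuous y := continuous_iff_continuousAt.2 fun t => (hy t).continuousAt
  set m : ℝ → ℝ := (Ioc 0 T).indicator (fun t => ‖y' t‖ ^ 2) with hmdef
  have hm : Integrable m := hiy'.integrable_indicator measurableSet_Ioc
  have hm0 : ∀ t, 0 ≤ m t := fun t => indicator_nonneg (fun t _ => by positivity) t
  have hmz : ∀ t, t ≤ 0 → m t = 0 := fun t ht =>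
    indicator_of_notMem (fun h => absurd h.1 (not_lt.2 ht)) _
  have hmI : ∫ t, m t = ∫ t in Ioc 0 T, ‖y' t‖ ^ 2 := integral_indicator measurableSet_Ioc
  set Φ : ℝ → ℝ := fun t => ∫ s in (0:ℝ)..t, m s with hΦ
  have hΦc : Continuous Φ :=
    intervalIntegral.continuous_primitive (fun a b => hm.intervalIntegrable) 0
  have hΦz : ∀ t, t ≤ 0 → Φ t = 0 := by
    intro t ht
    simp only [hΦ]
    rw [intervalIntegral.integral_symm, intervalIntegral.integral_of_le ht, neg_eq_zero]
    apply setIntegral_eq_zero_of_forall_eq_zero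
    intro s hs
    exact hmz s hs.2
  set δ : ℕ → ℝ := fun n => 1 / ((n : ℝ) + 1) with hδ
  have hδ0 : ∀ n, 0 < δ n := fun n => by simp only [hδ]; positivity
  set D : ℕ → ℝ → H := fun n t => (δ n)⁻¹ • (y (max t 0) - y (max (t - δ n) 0)) with hD
  set g : ℕ → ℝ → ℝ := fun n t => (δ n)⁻¹ * (Φ t - Φ (t - δ n)) with hg
  have hDc : ∀ n, Continuous (D n) := fun n => by simp only [hD]; fun_prop
  have hgc : ∀ n, Continuous (g n) := fun n => by simp only [hg]; fun_prop
  -- the difference quotient is controlled by the mean of the square of the derivative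
  have hDg : ∀ n, ∀ t ∈ Ioc 0 T, ‖D n t‖ ^ 2 ≤ g n t := by
    intro n t ht
    have hs0 : 0 ≤ max (t - δ n) 0 := le_max_right _ _
    have hst : max (t - δ n) 0 ≤ t := max_le (by linarith [hδ0 n]) ht.1.le
    have hsub : Ioc (max (t - δ n) 0) t ⊆ Ioc 0 T := Ioc_subset_Ioc hs0 ht.2
    have h1 := aux_incr hy hst (by linarith [le_max_left (t - δ n) (0:ℝ)]) (hδ0 n)
      ((intervalIntegrable_iff_integrableOn_Ioc_of_le hst).2 (hiy'.mono_set hsub))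
    have h2 : ∫ r in (max (t - δ n) 0)..t, ‖y' r‖ ^ 2 = ∫ r in (max (t - δ n) 0)..t, m r := by
      rw [intervalIntegral.integral_of_le hst, intervalIntegral.integral_of_le hst]
      refine setIntegral_congr_fun measurableSet_Ioc fun r hr => ?_
      rw [hmdef, indicator_of_mem (hsub hr)]
    have h3 : ∫ r in (max (t - δ n) 0)..t, m r = Φ t - Φ (max (t - δ n) 0) :=
      (intervalIntegral.integral_interval_sub_left hm.intervalIntegrable
        hm.intervalIntegrable).symm
    have h4 : Φ (max (t - δ n) 0) = Φ (t - δ n) := by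
      rcases le_total (t - δ n) 0 with h | h
      · rw [max_eq_right h, hΦz _ h, hΦz _ le_rfl]
      · rw [max_eq_left h]
    rw [h2, h3, h4] at h1
    simp only [hD, hg]
    rw [max_eq_left ht.1.le, norm_smul, mul_pow, Real.norm_eq_abs, sq_abs]
    have hδn := hδ0 n
    calc (δ n)⁻¹ ^ 2 * ‖y t - y (max (t - δ n) 0)‖ ^ 2
        ≤ (δ n)⁻¹ ^ 2 * (δ n * (Φ t - Φ (t - δ n))) := by gcongr
      _ = (δ n)⁻¹ * (Φ t - Φ (t - δ n)) := by field_simp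
  have hgint : ∀ n, ∫ t in Ioc 0 T, g n t ≤ ∫ t in Ioc 0 T, ‖y' t‖ ^ 2 := by
    intro n
    have h1 := aux_shift hT (hδ0 n) hm hm0 hmz
    simp only [hg]
    rw [integral_const_mul, ← hmI]
    rw [inv_mul_le_iff₀ (hδ0 n)]
    exact h1
  have hgi : ∀ n, IntegrableOn (g n) (Ioc 0 T) := fun n => (hgc n).integrableOn_Ioc
  have hem : ∀ n, AEMeasurable (fun t => k t * ‖D n t - y' t‖) (volume.restrict (Ioc 0 T)) :=
    fun n => hkm.mul (aux_meas_norm hy (hDc n)).aemeasurable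
  have hbound : ∀ n, ∀ t ∈ Ioc 0 T,
      k t * ‖D n t - y' t‖ ≤ k t ^ 2 / 2 + g n t + ‖y' t‖ ^ 2 := by
    intro n t ht
    have h1 := hDg n t ht
    have h2 := norm_sub_le (D n t) (y' t)
    have h3 : ‖D n t - y' t‖ ^ 2 ≤ 2 * ‖D n t‖ ^ 2 + 2 * ‖y' t‖ ^ 2 := by
      have := pow_le_pow_left₀ (norm_nonneg _) h2 2
      nlinarith [sq_nonneg (‖D n t‖ - ‖y' t‖)]
    nlinarith [sq_nonneg (k t - ‖D n t - y' t‖)]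
  have hk0 : ∀ t, 0 ≤ k t := fun t => (norm_nonneg _).trans (hk t)
  have hBi : ∀ n, IntegrableOn (fun t => k t ^ 2 / 2 + g n t + ‖y' t‖ ^ 2) (Ioc 0 T) :=
    fun n => ((hk2.div_const 2).add (hgi n)).add hiy'
  have hei : ∀ n, IntegrableOn (fun t => k t * ‖D n t - y' t‖) (Ioc 0 T) := by
    intro n
    refine (hBi n).mono' (hem n).aestronglyMeasurable ?_
    filter_upwards [ae_restrict_mem measurableSet_Ioc] with t ht
    rw [Real.norm_eq_abs, abs_of_nonneg (mul_nonneg (hk0 t) (norm_nonneg _))]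
    exact hbound n t ht
  -- lower bound
  have hlow : ∀ n, 0 ≤ (∫ t in Ioc 0 T, ⟪ζ t, y' t⟫) + ∫ t in Ioc 0 T, k t * ‖D n t - y' t‖ := by
    intro n
    have hψs : Integrable (fun t => ψ (t - δ n)) := hψ.comp_sub_right (δ n)
    have hψs0 : ∀ᵐ t, 0 ≤ ψ (t - δ n) :=
      (measurePreserving_sub_right volume (δ n)).quasiMeasurePreserving.ae hψ0
    have h1 : ∫ t in Ioc 0 T, ψ (t - δ n) ≤ ∫ t in Ioc 0 T, ψ t := by
      rw [setIntegral_eq_integral_of_forall_compl_eq_zero (f := ψ) hψz,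
        ← integral_sub_right_eq_self ψ (δ n)]
      exact setIntegral_le_integral hψs hψs0
    have h2 : 0 ≤ ∫ t in Ioc 0 T, (δ n)⁻¹ * (ψ t - ψ (t - δ n)) := by
      rw [integral_const_mul, integral_sub hψ.integrableOn hψs.integrableOn]
      exact mul_nonneg (inv_nonneg.2 (hδ0 n).le) (by linarith)
    refine h2.trans ?_
    rw [← integral_add hζ (hei n)]
    refine integral_mono_ae ((hψ.integrableOn.sub hψs.integrableOn).const_mul _)
      (hζ.add (hei n)) ?_
    filter_upwards [hineq (δ n) (hδ0 n)] with t ht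
    have h3 : (δ n)⁻¹ * (ψ t - ψ (t - δ n)) ≤ ⟪ζ t, D n t⟫ := by
      simp only [hD]
      rw [real_inner_smul_right]
      exact mul_le_mul_of_nonneg_left ht (inv_nonneg.2 (hδ0 n).le)
    have h4 : ⟪ζ t, D n t⟫ = ⟪ζ t, y' t⟫ + ⟪ζ t, D n t - y' t⟫ := by
      rw [← inner_add_right]; congr 1; abel
    have h5 : ⟪ζ t, D n t - y' t⟫ ≤ k t * ‖D n t - y' t‖ :=
      (real_inner_le_norm _ _).trans (mul_le_mul_of_nonneg_right (hk t) (norm_nonneg _))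
    change (δ n)⁻¹ * (ψ t - ψ (t - δ n)) ≤ ⟪ζ t, y' t⟫ + k t * ‖D n t - y' t‖
    linarith
  have hA : Integrable (fun t => k t ^ 2 / 2 + ‖y' t‖ ^ 2) (volume.restrict (Ioc 0 T)) :=
    (hk2.div_const 2).add hiy'
  have hAg : ∀ n, Integrable (fun t => k t ^ 2 / 2 + g n t) (volume.restrict (Ioc 0 T)) :=
    fun n => (hk2.div_const 2).add (hgi n)
  have hfat := aux_fatou (μ := volume.restrict (Ioc 0 T))
    (F := fun n t => k t ^ 2 / 2 + g n t + ‖y' t‖ ^ 2 - k t * ‖D n t - y' t‖)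
    (G := fun t => k t ^ 2 / 2 + ‖y' t‖ ^ 2 + ‖y' t‖ ^ 2)
    (C := (∫ t in Ioc 0 T, k t ^ 2 / 2) + (∫ t in Ioc 0 T, ‖y' t‖ ^ 2)
      + (∫ t in Ioc 0 T, ‖y' t‖ ^ 2) + ∫ t in Ioc 0 T, ⟪ζ t, y' t⟫)
    (fun n => Integrable.sub (hBi n) (hei n)) ?_ (hA.add hiy') ?_ ?_
  · rw [integral_add hA hiy',
      integral_add (hk2.div_const 2) hiy'] at hfat
    linarith
  · intro n
    filter_upwards [ae_restrict_mem measurableSet_Ioc] with t ht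
    exact sub_nonneg.2 (hbound n t ht)
  · have hL := ae_restrict_of_ae (s := Ioc 0 T)
      (LocallyIntegrable.ae_hasDerivAt_integral hm.locallyIntegrable)
    filter_upwards [ae_restrict_mem measurableSet_Ioc, hL] with t ht hLt
    have h1 : Tendsto (fun n => g n t) atTop (𝓝 (‖y' t‖ ^ 2)) := by
      have := aux_slope (hLt 0)
      rw [hmdef, indicator_of_mem ht] at this
      exact this
    have h2 : Tendsto (fun n => D n t) atTop (𝓝 (y' t)) := by
      have hd : HasDerivAt (fun r => y (max r 0)) (y' t) t := by
        refine (hy t).congr_of_eventuallyEq ?_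
        filter_upwards [lt_mem_nhds ht.1] with r hr
        rw [max_eq_left hr.le]
      exact aux_slope hd
    have h3 : Tendsto (fun n => k t * ‖D n t - y' t‖) atTop (𝓝 0) := by
      have := ((h2.sub_const (y' t)).norm).const_mul (k t)
      simpa using this
    have h4 := ((h1.const_add (k t ^ 2 / 2)).add_const (‖y' t‖ ^ 2)).sub h3
    rwa [sub_zero] at h4
  · intro n
    rw [integral_sub (hBi n) (hei n), integral_add (hAg n) hiy',
      integral_add (hk2.div_const 2) (hgi n)]
    linarith [hlow n, hgint n]

/-- Energy estimate for the gradient flow of a proper lsc convex functional `φ`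
(the case `κ = 0`): if `ẏ + η = u` with `η ∈ ∂φ(y)` a.e. and `y(0) = y⁰`, then
`(1/2)‖ẏ‖²_{L²} + ‖η‖²_{L²} ≤ ‖u‖²_{L²} + 2T‖(∂φ(y⁰))°‖²`, where `(∂φ(y⁰))°` is the
minimal-norm element `η₀` of `∂φ(y⁰)`. -/
theorem stmt_9 {H : Type*} [NormedAddCommGroup H] [InnerProductSpace ℝ H]
    (T : ℝ) (hT : 0 < T)
    (φ : H → EReal)
    (hproper : ∃ v, φ v ≠ ⊤) (hnobot : ∀ v, φ v ≠ ⊥)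
    (hconv : ∀ (w v : H) (r : ℝ), 0 ≤ r → r ≤ 1 →
      φ (r • w + (1 - r) • v) ≤ (r : EReal) * φ w + ((1 - r : ℝ) : EReal) * φ v)
    (hlsc : LowerSemicontinuous φ)
    (y y' η u : ℝ → H) (y0 η₀ : H)
    (hy : ∀ t, HasDerivAt y (y' t) t)
    (heq : ∀ᵐ t ∂(volume.restrict (Ioc 0 T)), y' t + η t = u t)
    (hmem : ∀ᵐ t ∂(volume.restrict (Ioc 0 T)), ∀ w : H,
      ((⟪η t, w - y t⟫ : ℝ) : EReal) + φ (y t) ≤ φ w)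
    (hy0 : y 0 = y0)
    (hη₀ : ∀ w : H, ((⟪η₀, w - y0⟫ : ℝ) : EReal) + φ y0 ≤ φ w)
    (hη₀min : ∀ ζ : H, (∀ w : H, ((⟪ζ, w - y0⟫ : ℝ) : EReal) + φ y0 ≤ φ w) → ‖η₀‖ ≤ ‖ζ‖)
    (hiy' : IntegrableOn (fun t => ‖y' t‖ ^ 2) (Ioc 0 T))
    (hiη : IntegrableOn (fun t => ‖η t‖ ^ 2) (Ioc 0 T))
    (hiu : IntegrableOn (fun t => ‖u t‖ ^ 2) (Ioc 0 T)) :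
    1 / 2 * (∫ t in Ioc 0 T, ‖y' t‖ ^ 2) + (∫ t in Ioc 0 T, ‖η t‖ ^ 2)
      ≤ (∫ t in Ioc 0 T, ‖u t‖ ^ 2) + 2 * T * ‖η₀‖ ^ 2 := by
  have hyc : Continuous y := continuous_iff_continuousAt.2 fun t => (hy t).continuousAt
  subst hy0
  have hf0 : φ (y 0) ≠ ⊤ := by
    intro h
    obtain ⟨v, hv⟩ := hproper
    have := hη₀ v
    rw [h, EReal.coe_add_top] at this
    exact hv (top_le_iff.1 this)
  set f : ℝ → ℝ := fun t => (φ (y t)).toReal with hf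
  have hsubd : ∀ (ξ : H) (t s : ℝ), φ (y t) ≠ ⊤ → φ (y s) ≠ ⊤ →
      ((⟪ξ, y s - y t⟫ : ℝ) : EReal) + φ (y t) ≤ φ (y s) → ⟪ξ, y s - y t⟫ + f t ≤ f s := by
    intro ξ t s h1 h2 h
    rw [← EReal.coe_toReal h1 (hnobot _), ← EReal.coe_toReal h2 (hnobot _)] at h
    exact_mod_cast h
  have hmem' : ∀ᵐ t, t ∈ Ioc 0 T → (φ (y t) ≠ ⊤ ∧ ∀ w : H,
      ((⟪η t, w - y t⟫ : ℝ) : EReal) + φ (y t) ≤ φ w) := by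
    filter_upwards [(ae_restrict_iff' measurableSet_Ioc).1 hmem] with t ht htm
    refine ⟨?_, ht htm⟩
    intro h
    have := ht htm (y 0)
    rw [h, EReal.coe_add_top] at this
    exact hf0 (top_le_iff.1 this)
  set ψ : ℝ → ℝ := (Ioc 0 T).indicator (fun t => f t - f 0 - ⟪η₀, y t - y 0⟫) with hψd
  set k : ℝ → ℝ := fun t => ‖η t‖ + ‖η₀‖ with hkd
  have hηm : AEMeasurable (fun t => ‖η t‖) (volume.restrict (Ioc 0 T)) := by
    have := hiη.aestronglyMeasurable.aemeasurable.sqrt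
    refine this.congr (Filter.Eventually.of_forall fun t => ?_)
    exact Real.sqrt_sq (norm_nonneg _)
  have hkm : AEMeasurable k (volume.restrict (Ioc 0 T)) := hηm.add_const _
  have hk2 : IntegrableOn (fun t => k t ^ 2) (Ioc 0 T) := by
    have hb : IntegrableOn (fun t => 2 * ‖η t‖ ^ 2 + 2 * ‖η₀‖ ^ 2) (Ioc 0 T) :=
      (hiη.const_mul 2).add (integrableOn_const (by simp))
    refine hb.mono' (hkm.pow_const 2).aestronglyMeasurable (Filter.Eventually.of_forall fun t => ?_)
    rw [Real.norm_eq_abs, abs_of_nonneg (by positivity)]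
    simp only [hkd]
    nlinarith [sq_nonneg (‖η t‖ - ‖η₀‖)]
  have hk : ∀ t, ‖η t - η₀‖ ≤ k t := fun t => norm_sub_le _ _
  have hk1 : IntegrableOn k (Ioc 0 T) := by
    have hb : IntegrableOn (fun t => k t ^ 2 + 1) (Ioc 0 T) :=
      hk2.add (integrableOn_const (by simp))
    refine hb.mono' hkm.aestronglyMeasurable (Filter.Eventually.of_forall fun t => ?_)
    rw [Real.norm_eq_abs]
    refine abs_le.2 ⟨?_, ?_⟩ <;> nlinarith [sq_nonneg (k t - 1), sq_nonneg (k t + 1)]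
  have hψ0 : ∀ᵐ t, 0 ≤ ψ t := by
    filter_upwards [hmem'] with t ht
    by_cases htm : t ∈ Ioc 0 T
    · rw [hψd, indicator_of_mem htm]
      have := hsubd η₀ 0 t hf0 (ht htm).1 (hη₀ (y t))
      linarith
    · rw [hψd, indicator_of_notMem htm]
  have hψz : ∀ t, t ∉ Ioc 0 T → ψ t = 0 := fun t ht => indicator_of_notMem ht _
  have hineq0 : ∀ᵐ t, t ∈ Ioc 0 T → ψ t ≤ ⟪η t - η₀, y t - y 0⟫ := by
    filter_upwards [hmem'] with t ht htm
    rw [hψd, indicator_of_mem htm]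
    have := hsubd (η t) t 0 (ht htm).1 hf0 ((ht htm).2 (y 0))
    rw [inner_sub_left]
    have h2 : ⟪η t, y 0 - y t⟫ = -⟪η t, y t - y 0⟫ := by rw [← inner_neg_right, neg_sub]
    linarith
  have hfm : Measurable f := by
    have h1 : LowerSemicontinuous (fun t => φ (y t)) := hlsc.comp hyc
    exact h1.measurable.ereal_toReal
  have hψi : Integrable ψ := by
    have hc2 : Continuous fun t => ⟪η₀, y t - y 0⟫ := by fun_prop
    have hψm : Measurable ψ :=
      ((hfm.sub_const _).sub hc2.measurable).indicator measurableSet_Ioc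
    obtain ⟨C, hC⟩ := (isCompact_Icc (a := (0:ℝ)) (b := T)).exists_bound_of_continuousOn
      (f := fun t => y t - y 0) (by fun_prop)
    rw [← integrableOn_iff_integrable_of_support_subset (s := Ioc 0 T)
      (Set.support_indicator_subset)]
    refine (hk1.mul_const C).mono' hψm.aestronglyMeasurable ?_
    filter_upwards [ae_restrict_of_ae hψ0, ae_restrict_of_ae hineq0,
      ae_restrict_mem measurableSet_Ioc] with t h1 h2 h3
    rw [Real.norm_eq_abs, abs_of_nonneg h1]
    refine (h2 h3).trans ((real_inner_le_norm _ _).trans ?_)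
    exact mul_le_mul (hk t) (hC t ⟨h3.1.le, h3.2⟩) (norm_nonneg _) ((norm_nonneg _).trans (hk t))
  have hineq : ∀ h : ℝ, 0 < h → ∀ᵐ t ∂(volume.restrict (Ioc 0 T)),
      ψ t - ψ (t - h) ≤ ⟪η t - η₀, y (max t 0) - y (max (t - h) 0)⟫ := by
    intro h hh
    have hsh := (measurePreserving_sub_right volume h).quasiMeasurePreserving.ae hmem'
    filter_upwards [ae_restrict_of_ae hmem', ae_restrict_of_ae hsh, ae_restrict_of_ae hineq0,
      ae_restrict_mem measurableSet_Ioc] with t h1 h2 h3 htm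
    rw [max_eq_left htm.1.le]
    rcases le_or_gt (t - h) 0 with hle | hgt
    · rw [max_eq_right hle, hψz (t - h) (fun hm => absurd hm.1 (not_lt.2 hle)), sub_zero]
      exact h3 htm
    · have hsm : t - h ∈ Ioc 0 T := ⟨hgt, by linarith [htm.2]⟩
      rw [max_eq_left hgt.le, hψd, indicator_of_mem htm, indicator_of_mem hsm]
      have := hsubd (η t) t (t - h) (h1 htm).1 (h2 hsm).1 ((h1 htm).2 (y (t - h)))
      simp only [inner_sub_left, inner_sub_right] at this ⊢
      linarith
  have hexp : ∀ᵐ t ∂(volume.restrict (Ioc 0 T)),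
      ⟪η t, y' t⟫ = (‖u t‖ ^ 2 - ‖y' t‖ ^ 2 - ‖η t‖ ^ 2) / 2 := by
    filter_upwards [heq] with t ht
    rw [← ht, norm_add_sq_real, real_inner_comm]
    ring
  have hpt : ∀ t, |⟪η₀, y' t⟫| ≤ ‖η₀‖ ^ 2 + ‖y' t‖ ^ 2 / 4 := by
    intro t
    refine (abs_real_inner_le_norm _ _).trans ?_
    nlinarith [sq_nonneg (‖η₀‖ - ‖y' t‖ / 2)]
  have hbi : IntegrableOn (fun t => ‖η₀‖ ^ 2 + ‖y' t‖ ^ 2 / 4) (Ioc 0 T) :=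
    (integrableOn_const (by simp)).add (hiy'.div_const 4)
  have hi0 : IntegrableOn (fun t => ⟪η₀, y' t⟫) (Ioc 0 T) :=
    hbi.mono' (aux_meas hy η₀).aestronglyMeasurable (Filter.Eventually.of_forall hpt)
  have hei : IntegrableOn (fun t => (‖u t‖ ^ 2 - ‖y' t‖ ^ 2 - ‖η t‖ ^ 2) / 2) (Ioc 0 T) :=
    ((hiu.sub hiy').sub hiη).div_const 2
  have hζe : (fun t => (‖u t‖ ^ 2 - ‖y' t‖ ^ 2 - ‖η t‖ ^ 2) / 2 - ⟪η₀, y' t⟫)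
      =ᵐ[volume.restrict (Ioc 0 T)] (fun t => ⟪η t - η₀, y' t⟫) := by
    filter_upwards [hexp] with t ht
    rw [inner_sub_left, ht]
  have hζ : IntegrableOn (fun t => ⟪η t - η₀, y' t⟫) (Ioc 0 T) :=
    (hei.sub hi0).congr hζe
  have hkey := aux_key (ζ := fun t => η t - η₀) hT hy hiy' hkm hk2 hk hζ hψi hψ0 hψz hineq
  have huy : Integrable (fun t => ‖u t‖ ^ 2 - ‖y' t‖ ^ 2) (volume.restrict (Ioc 0 T)) :=
    hiu.sub hiy'
  rw [← integral_congr_ae hζe, integral_sub hei hi0, integral_div,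
    integral_sub huy hiη, integral_sub hiu hiy'] at hkey
  have hlast : -(∫ t in Ioc 0 T, ⟪η₀, y' t⟫) ≤
      T * ‖η₀‖ ^ 2 + (∫ t in Ioc 0 T, ‖y' t‖ ^ 2) / 4 := by
    rw [← integral_neg]
    have : ∫ t in Ioc 0 T, -⟪η₀, y' t⟫ ≤ ∫ t in Ioc 0 T, (‖η₀‖ ^ 2 + ‖y' t‖ ^ 2 / 4) :=
      integral_mono hi0.neg hbi (fun t => (neg_le_abs _).trans (hpt t))
    refine this.trans (le_of_eq ?_)
    rw [integral_add (integrable_const _) (hiy'.div_const 4), integral_div,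
      setIntegral_const]
    simp [hT.le]
  linarith
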